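/- Let A : ℝ → Mₙ(ℝ) be a C¹ path of symmetric n×n real matrices and S : ℝ → Mₙ(ℝ) a path of matrices such that A′(t) + A(t)² + S(t) = 0 for all t. Then the scalar function a(t) = tr A(t) satisfies the Riccati-type inequality a′(t) + a(t)²/n + tr S(t) ≤ 0 for all t. -/

import Mathlib

open MeasureTheory
open scoped ContDiff

noncomputable section

/-- `E n` is Euclidean `n`-space `ℝⁿ`. -/
abbrev E (n : ℕ) := EuclideanSpace ℝ (Fin n)

/-- The fundamental cube `[0,1]ⁿ`. -/
def cube (n : ℕ) : Set (E n) := {q | ∀ i, q i ∈ Set.Icc (0:ℝ) 1}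

/-- The partial derivative `∂u/∂qᵢ`. -/
def pdq (n : ℕ) (u : E n → ℝ → ℝ) (i : Fin n) (q : E n) (t : ℝ) : ℝ :=
  fderiv ℝ (fun q' => u q' t) q (EuclideanSpace.single i 1)

/-- The squared norm of the gradient in the `q`-variables, `|∇_q u|²`. -/
def gradSq (n : ℕ) (u : E n → ℝ → ℝ) (q : E n) (t : ℝ) : ℝ :=
  ∑ i, (pdq n u i q t)^2

/-- The Laplacian in the `q`-variables, `Δ_q u`. -/
def lapQ (n : ℕ) (u : E n → ℝ → ℝ) (q : E n) (t : ℝ) : ℝ :=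
  ∑ i, fderiv ℝ (fun q' => pdq n u i q' t) q (EuclideanSpace.single i 1)

/-- The Hamiltonian `H(p,q,t) = |p|²/2 + u(q,t)`. -/
def Ham (n : ℕ) (u : E n → ℝ → ℝ) (p q : E n) (t : ℝ) : ℝ := ‖p‖^2/2 + u q t

/-- `∫ f dμ` over `(p,q,t) ∈ ℝⁿ × [0,1]ⁿ × [0,1]` w.r.t. Lebesgue measure `dp dq dt`. -/
def intMu (n : ℕ) (f : E n → E n → ℝ → ℝ) : ℝ :=
  ∫ t in Set.Icc (0:ℝ) 1, ∫ q in cube n, ∫ p : E n, f p q t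

/-- `∫ f dq dt` over `(q,t) ∈ [0,1]ⁿ × [0,1]`. -/
def intQT (n : ℕ) (f : E n → ℝ → ℝ) : ℝ :=
  ∫ t in Set.Icc (0:ℝ) 1, ∫ q in cube n, f q t

/-- The surface measure (`(n-1)`-dimensional Hausdorff measure) of the unit
sphere `S^{n-1} ⊂ ℝⁿ`. -/
def omegaN (n : ℕ) : ℝ :=
  (μH[(n:ℝ) - 1] (Metric.sphere (0 : E n) 1)).toReal

/-- `D_α`: the discriminant quantity built from the stretched cutoff `ρ_α(x) = ρ(αx)`. -/
def Dalpha (n : ℕ) (u : E n → ℝ → ℝ) (ρ : ℝ → ℝ) (α : ℝ) : ℝ :=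
  intMu n (fun p q t =>
    (deriv (fun x => ρ (α * x)) (Ham n u p q t))^2 * (deriv (u q) t)^2)
  + (1/(n:ℝ)) * intMu n (fun p q t =>
    deriv (fun x => (ρ (α * x))^2) (Ham n u p q t) * gradSq n u q t)

/-- The derivative of `a` along the vector field
`v = ∂_t + Σᵢ pᵢ ∂_{qᵢ} − Σᵢ u_{qᵢ} ∂_{pᵢ}`. -/
def lieV (n : ℕ) (u : E n → ℝ → ℝ) (a : E n → E n → ℝ → ℝ) (p q : E n) (t : ℝ) : ℝ :=
  deriv (a p q) t
  + ∑ i, p i * fderiv ℝ (fun q' => a p q' t) q (EuclideanSpace.single i 1)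
  - ∑ i, pdq n u i q t * fderiv ℝ (fun p' => a p' q t) p (EuclideanSpace.single i 1)

/-- For a symmetric real matrix `M`, `(tr M)² / n ≤ tr (M²)`. -/
theorem Matrix.IsSymm.sq_trace_div_card_le_trace_mul_self {ι : Type*} [Fintype ι]
    {M : Matrix ι ι ℝ} (hM : M.IsSymm) :
    M.trace ^ 2 / Fintype.card ι ≤ (M * M).trace := by
  have h_trace : (M * M).trace = ∑ i, ∑ j, M i j ^ 2 := by
    simp only [Matrix.trace, Matrix.diag_apply, Matrix.mul_apply]
    refine Finset.sum_congr rfl fun i _ => Finset.sum_congr rfl fun j _ => ?_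
    rw [hM.apply i j, sq]
  have h_diag : ∑ i, M i i ^ 2 ≤ (M * M).trace := by
    rw [h_trace]
    exact Finset.sum_le_sum fun i _ =>
      Finset.single_le_sum (f := fun j => M i j ^ 2) (fun j _ => sq_nonneg _) (Finset.mem_univ i)
  refine div_le_of_le_mul₀ (Nat.cast_nonneg _)
    ((Finset.sum_nonneg fun i _ => sq_nonneg _).trans h_diag) ?_
  calc M.trace ^ 2 ≤ Fintype.card ι * ∑ i, M i i ^ 2 :=
        sq_sum_le_card_mul_sum_sq (s := Finset.univ) (f := fun i => M i i)
    _ ≤ (M * M).trace * Fintype.card ι := by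
        rw [mul_comm]
        gcongr

theorem riccati_trace_inequality (n : ℕ) (hn : 1 ≤ n)
    (A A' S : ℝ → Matrix (Fin n) (Fin n) ℝ)
    (hA : ∀ (i j : Fin n) (t : ℝ), HasDerivAt (fun s => A s i j) (A' t i j) t)
    (hsymm : ∀ t : ℝ, (A t).IsSymm)
    (hric : ∀ t : ℝ, A' t + A t * A t + S t = 0) :
    ∀ t : ℝ, (A' t).trace + ((A t).trace)^2 / n + (S t).trace ≤ 0 := by
  intro t
  have h_trace := congrArg Matrix.trace (hric t)
  rw [Matrix.trace_add, Matrix.trace_add, Matrix.trace_zero] at h_trace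
  have h_le := (hsymm t).sq_trace_div_card_le_trace_mul_self
  rw [Fintype.card_fin] at h_le
  linarith
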